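/- R(K₃, K₃, K₃, K₃+e) ≥ 52. That is, there exists an assignment of one of 4 colors to the edges of the complete graph K₅₁ such that colors 1, 2 and 3 contain no triangle K₃ and color 4 contains no paw graph K₃+e. -/

import Mathlib

open SimpleGraph

/-- `G` contains a subgraph isomorphic to `H`:
there is an injective map from the vertices of `H` to those of `G` preserving adjacency. -/
def Contains {V W : Type*} (G : SimpleGraph V) (H : SimpleGraph W) : Prop :=
  ∃ f : W → V, Function.Injective f ∧ ∀ ⦃a b : W⦄, H.Adj a b → G.Adj (f a) (f b)

/-- The triangle `K₃`. -/
def triangle : SimpleGraph (Fin 3) := ⊤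

/-- The paw graph `K₃ + e`: a triangle `{0, 1, 2}` with a pendant edge `{2, 3}`. -/
def paw : SimpleGraph (Fin 4) :=
  SimpleGraph.fromEdgeSet {s(0, 1), s(0, 2), s(1, 2), s(2, 3)}

/-- `J₄ = K₄ - e`, the complete graph on 4 vertices with one edge deleted. -/
def J4 : SimpleGraph (Fin 4) := (⊤ : SimpleGraph (Fin 4)).deleteEdges {s(0, 1)}

/-- The graph formed by the edges of color `i` in the edge coloring `c` of `K_n`. -/
def colorClass {n m : ℕ} (c : Sym2 (Fin n) → Fin m) (i : Fin m) : SimpleGraph (Fin n) :=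
  SimpleGraph.fromEdgeSet {e | c e = i}

/-- A `(G1, G2, G3, G4; n)`-coloring: a 4-coloring of the edges of `K_n` such that
color `i` contains no subgraph isomorphic to `Gi`. -/
def GoodColoring4 {a b d e : ℕ} (G1 : SimpleGraph (Fin a)) (G2 : SimpleGraph (Fin b))
    (G3 : SimpleGraph (Fin d)) (G4 : SimpleGraph (Fin e)) (n : ℕ) : Prop :=
  ∃ c : Sym2 (Fin n) → Fin 4,
    ¬ Contains (colorClass c 0) G1 ∧ ¬ Contains (colorClass c 1) G2 ∧
      ¬ Contains (colorClass c 2) G3 ∧ ¬ Contains (colorClass c 3) G4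

/-- The 4-color Ramsey number `R(G1, G2, G3, G4)`:
the least `n` such that no `(G1, G2, G3, G4; n)`-coloring exists. -/
noncomputable def Ramsey4 {a b d e : ℕ} (G1 : SimpleGraph (Fin a)) (G2 : SimpleGraph (Fin b))
    (G3 : SimpleGraph (Fin d)) (G4 : SimpleGraph (Fin e)) : ℕ :=
  sInf {n : ℕ | ¬ GoodColoring4 G1 G2 G3 G4 n}

/-! ### Finiteness of the Ramsey number -/

/-- Every coloring of the pairs of a set with `4 ^ ∑ i, a i` elements by four colors has, for some
color `i`, a set of `a i` elements all of whose pairs have color `i`. -/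
theorem exists_monochromatic_finset {V : Type*} [DecidableEq V] (c : Sym2 V → Fin 4) (s : ℕ) :
    ∀ (a : Fin 4 → ℕ), ∑ i, a i = s → ∀ S : Finset V, 4 ^ s ≤ S.card →
      ∃ i, ∃ T ⊆ S, T.card = a i ∧ (T : Set V).Pairwise fun x y => c s(x, y) = i := by
  induction s with
  | zero =>
    intro a ha S _
    refine ⟨0, ∅, by simp, ?_, by simp⟩
    simpa using ((Finset.sum_eq_zero_iff.1 ha) 0 (Finset.mem_univ _)).symm
  | succ s ih =>
    intro a ha S hS
    by_cases h0 : ∃ i, a i = 0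
    · obtain ⟨i, hi⟩ := h0
      exact ⟨i, ∅, by simp, by simp [hi], by simp⟩
    push Not at h0
    obtain ⟨v, hv⟩ : S.Nonempty := Finset.card_pos.1 (lt_of_lt_of_le (by positivity) hS)
    obtain ⟨i, -, hi⟩ : ∃ i ∈ (Finset.univ : Finset (Fin 4)),
        4 ^ s - 1 < ((S.erase v).filter fun w => c s(v, w) = i).card := by
      refine Finset.exists_lt_card_fiber_of_mul_lt_card_of_maps_to
        (fun _ _ => Finset.mem_univ _) ?_
      have h4 : 0 < 4 ^ s := by positivity
      rw [Finset.card_erase_of_mem hv, Finset.card_univ, Fintype.card_fin]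
      rw [pow_succ] at hS
      omega
    have hsum : ∑ j, Function.update a i (a i - 1) j = s := by
      have h := Finset.add_sum_erase Finset.univ a (Finset.mem_univ i)
      rw [Finset.sum_update_of_mem (Finset.mem_univ i), Finset.sdiff_singleton_eq_erase]
      have := h0 i
      omega
    obtain ⟨j, T, hTS, hT, hc⟩ := ih _ hsum _ (Nat.le_of_pred_lt hi)
    have hTS' : T ⊆ S.erase v := hTS.trans (Finset.filter_subset _ _)
    by_cases hj : j = i
    · subst hj
      have hvT : v ∉ T := fun h => Finset.notMem_erase v S (hTS' h)
      refine ⟨j, insert v T, ?_, ?_, ?_⟩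
      · exact Finset.insert_subset hv (hTS'.trans (Finset.erase_subset _ _))
      · have := h0 j
        rw [Finset.card_insert_of_notMem hvT, hT, Function.update_self]
        omega
      · rw [Finset.coe_insert, Set.pairwise_insert]
        refine ⟨hc, fun w hw _ => ?_⟩
        rw [Sym2.eq_swap (a := w), and_self]
        exact (Finset.mem_filter.1 (hTS hw)).2
    · exact ⟨j, T, hTS'.trans (Finset.erase_subset _ _),
        by rw [hT, Function.update_of_ne hj], hc⟩

theorem colorClass_adj {n m : ℕ} (c : Sym2 (Fin n) → Fin m) (i : Fin m) (x y : Fin n) :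
    (colorClass c i).Adj x y ↔ c s(x, y) = i ∧ x ≠ y := by
  simp [colorClass]

/-- A monochromatic set of `k` vertices contains every graph on `k` vertices. -/
theorem contains_colorClass_of_pairwise {n m k : ℕ} {c : Sym2 (Fin n) → Fin m} {i : Fin m}
    {T : Finset (Fin n)} (hT : T.card = k)
    (hc : (T : Set (Fin n)).Pairwise fun x y => c s(x, y) = i) (H : SimpleGraph (Fin k)) :
    Contains (colorClass c i) H := by
  refine ⟨T.orderEmbOfFin hT, (T.orderEmbOfFin hT).injective, fun a b hab => ?_⟩
  have hne := (T.orderEmbOfFin hT).injective.ne hab.ne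
  rw [colorClass_adj]
  exact ⟨hc (T.orderEmbOfFin_mem hT a) (T.orderEmbOfFin_mem hT b) hne, hne⟩

theorem exists_not_goodColoring4 {a b d e : ℕ} (G1 : SimpleGraph (Fin a))
    (G2 : SimpleGraph (Fin b)) (G3 : SimpleGraph (Fin d)) (G4 : SimpleGraph (Fin e)) :
    ∃ n, ¬ GoodColoring4 G1 G2 G3 G4 n := by
  refine ⟨4 ^ ∑ i, ![a, b, d, e] i, fun ⟨c, h1, h2, h3, h4⟩ => ?_⟩
  obtain ⟨i, T, -, hT, hc⟩ :=
    exists_monochromatic_finset c _ ![a, b, d, e] rfl Finset.univ (by simp)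
  fin_cases i
  · exact h1 (contains_colorClass_of_pairwise hT hc G1)
  · exact h2 (contains_colorClass_of_pairwise hT hc G2)
  · exact h3 (contains_colorClass_of_pairwise hT hc G3)
  · exact h4 (contains_colorClass_of_pairwise hT hc G4)

/-! ### Pulling back colorings -/

theorem Contains.of_map_colorClass {n k m r : ℕ} {c : Sym2 (Fin n) → Fin m} {i : Fin m}
    {H : SimpleGraph (Fin r)} {φ : Fin k → Fin n} (hφ : Function.Injective φ)
    (h : Contains (colorClass (c ∘ Sym2.map φ) i) H) : Contains (colorClass c i) H := by
  obtain ⟨f, hf, hadj⟩ := h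
  refine ⟨φ ∘ f, hφ.comp hf, fun x y hxy => ?_⟩
  have := (colorClass_adj _ _ _ _).1 (hadj hxy)
  exact (colorClass_adj _ _ _ _).2 ⟨this.1, hφ.ne this.2⟩

theorem GoodColoring4.mono {a b d e k n : ℕ} {G1 : SimpleGraph (Fin a)}
    {G2 : SimpleGraph (Fin b)} {G3 : SimpleGraph (Fin d)} {G4 : SimpleGraph (Fin e)}
    (hkn : k ≤ n) (h : GoodColoring4 G1 G2 G3 G4 n) : GoodColoring4 G1 G2 G3 G4 k := by
  obtain ⟨c, h1, h2, h3, h4⟩ := h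
  have hφ := Fin.castLE_injective hkn
  exact ⟨c ∘ Sym2.map (Fin.castLE hkn), fun h => h1 (h.of_map_colorClass hφ),
    fun h => h2 (h.of_map_colorClass hφ), fun h => h3 (h.of_map_colorClass hφ),
    fun h => h4 (h.of_map_colorClass hφ)⟩

/-- A good coloring of `K_n` bounds the Ramsey number from below. -/
theorem GoodColoring4.lt_ramsey4 {a b d e n : ℕ} {G1 : SimpleGraph (Fin a)}
    {G2 : SimpleGraph (Fin b)} {G3 : SimpleGraph (Fin d)} {G4 : SimpleGraph (Fin e)}
    (h : GoodColoring4 G1 G2 G3 G4 n) : n < Ramsey4 G1 G2 G3 G4 :=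
  le_csInf (exists_not_goodColoring4 G1 G2 G3 G4) fun _ hk =>
    Nat.lt_of_not_le fun hkn => hk (h.mono hkn)

/-! ### The coloring of `K₅₁` -/

/-- The cubic residue classes of the field with 16 elements, represented by polynomials over the
field with two elements modulo `X ^ 4 + X + 1`, whose coefficients are read as binary digits.
The class of `0` is `0`. -/
def cubicClass : Fin 16 → Fin 4 :=
  ![0, 1, 2, 2, 3, 3, 3, 2, 1, 3, 1, 2, 1, 2, 3, 1]

/-- The Greenwood–Gleason coloring of `K₁₆` with colors `1`, `2`, `3`; the diagonal gets `0`. -/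
def greenwoodGleason (x y : Fin 16) : Fin 4 := cubicClass (x ^^^ y)

theorem greenwoodGleason_comm (x y : Fin 16) : greenwoodGleason x y = greenwoodGleason y x := by
  revert x y; decide +kernel

theorem greenwoodGleason_eq_zero {x y : Fin 16} (h : greenwoodGleason x y = 0) : x = y := by
  revert x y; decide +kernel

theorem greenwoodGleason_triangle {x y z : Fin 16}
    (hxy : greenwoodGleason x y = greenwoodGleason x z)
    (hyz : greenwoodGleason y z = greenwoodGleason x z) : greenwoodGleason x z = 0 := by
  revert x y z; decide +kernel

/-- The color between two points, lying in blocks `i` and `j`, whose positions in the blocks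
have Greenwood–Gleason color `m`. -/
def blockColor (i j : Fin 3) (m : Fin 4) : Fin 4 :=
  Fin.lastCases (motive := fun _ => Fin 4) (Fin.last 3)
    (fun r : Fin 3 => (if i = j then -(i + j) + r else -(i + j) - r).castSucc) m

theorem blockColor_comm (i j : Fin 3) (m : Fin 4) : blockColor i j m = blockColor j i m := by
  revert i j m; decide +kernel

theorem blockColor_self_ne {i : Fin 3} {m : Fin 4} (hm : m ≠ 0) :
    blockColor i i m ≠ i.castSucc := by
  revert i m; decide +kernel

set_option synthInstance.maxSize 1000 in
/-- No monochromatic triangle arises between points of three blocks when the colors `p`, `q`, `r`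
of their positions satisfy the constraints of the Greenwood–Gleason coloring, and points of the
same block have different positions. -/
theorem blockColor_triangle {i j k : Fin 3} {p q r : Fin 4}
    (hp : p = 0 → q = r) (hq : q = 0 → p = r) (hr : r = 0 → p = q)
    (hpqr : p = r → q = r → r = 0)
    (hij : i = j → p ≠ 0) (hjk : j = k → q ≠ 0) (hik : i = k → r ≠ 0)
    (h : blockColor i j p = blockColor i k r) : blockColor j k q ≠ blockColor i k r := by
  revert i j k p q r; decide +kernel

/-- Three blocks of 16 vertices and three further vertices, the apexes. -/
abbrev BlockVertex : Type := (Fin 3 × Fin 16) ⊕ Fin 3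

/-- The coloring of pairs: block `i` is joined to the apexes in color `i`, and the apexes are
joined to each other in color `3`. -/
def vertexColor : BlockVertex → BlockVertex → Fin 4
  | .inl (i, x), .inl (j, y) => blockColor i j (greenwoodGleason x y)
  | .inl (i, _), .inr _ => i.castSucc
  | .inr _, .inl (i, _) => i.castSucc
  | .inr _, .inr _ => Fin.last 3

theorem vertexColor_comm (u v : BlockVertex) : vertexColor u v = vertexColor v u := by
  rcases u with ⟨i, x⟩ | u <;> rcases v with ⟨j, y⟩ | v <;> simp only [vertexColor]
  rw [blockColor_comm, greenwoodGleason_comm]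

/-- A point of a block and an apex lie in no monochromatic triangle. -/
theorem vertexColor_inl_inr_ne {i : Fin 3} {x : Fin 16} {b : Fin 3} {w : BlockVertex}
    (hw : w ≠ .inl (i, x)) (h : vertexColor (.inl (i, x)) w = i.castSucc) :
    vertexColor w (.inr b) ≠ i.castSucc := by
  rcases w with ⟨j, y⟩ | w
  · intro hj
    obtain rfl : j = i := Fin.castSucc_injective 3 hj
    refine blockColor_self_ne (fun h0 => hw ?_) h
    rw [greenwoodGleason_eq_zero h0]
  · exact (Fin.castSucc_lt_last i).ne'

/-- The only monochromatic triangle is the one formed by the apexes. -/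
theorem isRight_of_monochromatic {u v w : BlockVertex} (huv : u ≠ v) (hvw : v ≠ w) (huw : u ≠ w)
    (h₁ : vertexColor u v = vertexColor u w) (h₂ : vertexColor v w = vertexColor u w) :
    u.isRight ∧ v.isRight ∧ w.isRight := by
  rcases u with ⟨i, x⟩ | u
  · exfalso
    rcases w with ⟨k, z⟩ | w
    · rcases v with ⟨j, y⟩ | v
      · refine blockColor_triangle (p := greenwoodGleason x y) (q := greenwoodGleason y z)
          (r := greenwoodGleason x z) ?_ ?_ ?_ greenwoodGleason_triangle ?_ ?_ ?_ h₁ h₂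
        · intro h; rw [greenwoodGleason_eq_zero h]
        · intro h; rw [greenwoodGleason_eq_zero h]
        · intro h; rw [greenwoodGleason_eq_zero h, greenwoodGleason_comm]
        · rintro rfl h; exact huv (by rw [greenwoodGleason_eq_zero h])
        · rintro rfl h; exact hvw (by rw [greenwoodGleason_eq_zero h])
        · rintro rfl h; exact huw (by rw [greenwoodGleason_eq_zero h])
      · exact vertexColor_inl_inr_ne huw.symm h₁.symm
          ((vertexColor_comm _ (.inr v)).trans (h₂.trans h₁.symm))
    · exact vertexColor_inl_inr_ne huv.symm h₁ h₂
  · rcases v with ⟨j, y⟩ | v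
    · exact absurd ((vertexColor_comm w (.inr u)).trans h₁.symm)
        (vertexColor_inl_inr_ne hvw.symm (h₂.trans h₁.symm))
    · rcases w with ⟨k, z⟩ | w
      · exact absurd h₁ (Fin.castSucc_lt_last k).ne'
      · exact ⟨rfl, rfl, rfl⟩

theorem isRight_of_vertexColor_eq_last {b : Fin 3} {w : BlockVertex}
    (h : vertexColor (.inr b) w = Fin.last 3) : w.isRight := by
  rcases w with ⟨i, x⟩ | w
  · exact absurd h (Fin.castSucc_lt_last i).ne
  · rfl

theorem vertexColor_eq_last_of_isRight {v w : BlockVertex} (hv : v.isRight) (hw : w.isRight) :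
    vertexColor v w = Fin.last 3 := by
  obtain ⟨a, rfl⟩ := Sum.isRight_iff.1 hv
  obtain ⟨b, rfl⟩ := Sum.isRight_iff.1 hw
  rfl

/-- A labeling of the vertices of `K₅₁` by the points of the blocks and the apexes. -/
noncomputable def vertexLabel : Fin 51 ≃ BlockVertex :=
  (Fintype.equivFinOfCardEq (by simp)).symm

/-- The coloring of the edges of `K₅₁`. -/
noncomputable def edgeColor : Sym2 (Fin 51) → Fin 4 :=
  Sym2.lift ⟨fun a b => vertexColor (vertexLabel a) (vertexLabel b),
    fun _ _ => vertexColor_comm _ _⟩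

theorem isRight_of_edgeColor_triangle {i : Fin 4} {a b c : Fin 51}
    (hab : (colorClass edgeColor i).Adj a b) (hbc : (colorClass edgeColor i).Adj b c)
    (hac : (colorClass edgeColor i).Adj a c) :
    (vertexLabel a).isRight ∧ (vertexLabel b).isRight ∧ (vertexLabel c).isRight := by
  rw [colorClass_adj] at hab hbc hac
  exact isRight_of_monochromatic (vertexLabel.injective.ne hab.2)
    (vertexLabel.injective.ne hbc.2) (vertexLabel.injective.ne hac.2)
    (hab.1.trans hac.1.symm) (hbc.1.trans hac.1.symm)

theorem not_contains_triangle_edgeColor {i : Fin 4} (hi : i ≠ Fin.last 3) :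
    ¬ Contains (colorClass edgeColor i) triangle := by
  rintro ⟨f, -, hadj⟩
  have h01 := hadj (a := 0) (b := 1) (by simp [triangle])
  have h12 := hadj (a := 1) (b := 2) (by simp [triangle])
  have h02 := hadj (a := 0) (b := 2) (by simp [triangle])
  obtain ⟨h0, h1, -⟩ := isRight_of_edgeColor_triangle h01 h12 h02
  exact hi (((colorClass_adj _ _ _ _).1 h01).1.symm.trans (vertexColor_eq_last_of_isRight h0 h1))

theorem not_contains_paw_edgeColor : ¬ Contains (colorClass edgeColor (Fin.last 3)) paw := by
  rintro ⟨f, hf, hadj⟩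
  have h01 := hadj (a := 0) (b := 1) (by simp [paw])
  have h12 := hadj (a := 1) (b := 2) (by simp [paw])
  have h02 := hadj (a := 0) (b := 2) (by simp [paw])
  have h23 := hadj (a := 2) (b := 3) (by simp [paw])
  obtain ⟨h0, h1, h2⟩ := isRight_of_edgeColor_triangle h01 h12 h02
  have h3 : (vertexLabel (f 3)).isRight := by
    obtain ⟨b, hb⟩ := Sum.isRight_iff.1 h2
    have h := ((colorClass_adj _ _ _ _).1 h23).1
    exact isRight_of_vertexColor_eq_last (b := b) (by rw [← hb]; exact h)
  have hall : ∀ x, ∃ b, vertexLabel (f x) = .inr b := by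
    intro x
    rw [← Sum.isRight_iff]
    fin_cases x <;> assumption
  choose g hg using hall
  have hinj : Function.Injective g := fun x y hxy =>
    hf (vertexLabel.injective (by rw [hg, hg, hxy]))
  simpa using Fintype.card_le_of_injective g hinj

theorem goodColoring4_triangle_paw : GoodColoring4 triangle triangle triangle paw 51 :=
  ⟨edgeColor, not_contains_triangle_edgeColor (by decide),
    not_contains_triangle_edgeColor (by decide), not_contains_triangle_edgeColor (by decide),
    not_contains_paw_edgeColor⟩

/-- `R(K₃, K₃, K₃, K₃+e) ≥ 52`: there is a 4-coloring of the edges of `K₅₁` in which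
colors 1, 2, 3 contain no triangle and color 4 contains no paw. -/
theorem ramsey4_K3_K3_K3_paw_ge_52 :
    52 ≤ Ramsey4 triangle triangle triangle paw ∧
      GoodColoring4 triangle triangle triangle paw 51 := by
  exact ⟨goodColoring4_triangle_paw.lt_ramsey4, goodColoring4_triangle_paw⟩
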